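/- For every positive integer k, the numerical semigroup generated by S = {3k+1, 6k−1, 6k} is a 3-permutation numerical semigroup. -/

import Mathlib

/-- The increasing enumeration of the positive elements of a submonoid `G` of `ℕ`
(0-indexed: `posSeq G 0` is the smallest positive element `g₁` of `G`). -/
noncomputable def posSeq (G : AddSubmonoid ℕ) : ℕ → ℕ :=
  Nat.nth (fun x => x ∈ G ∧ 0 < x)

/-- `G` is an `n`-permutation numerical semigroup: `G` is a cofinite submonoid of `ℕ`,
it is generated by its `n` smallest positive elements `g₁ < ⋯ < gₙ`, and for every
`k ≥ 0` the tuple `(g_{kn+1} mod n, …, g_{kn+n} mod n)` contains exactly one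
representative of each residue class of `ℤ/nℤ`. -/
def IsPermutationSemigroup (n : ℕ) (G : AddSubmonoid ℕ) : Prop :=
  ((G : Set ℕ)ᶜ).Finite ∧
  G = AddSubmonoid.closure (posSeq G '' Set.Iio n) ∧
  ∀ k : ℕ, Function.Bijective (fun j : Fin n => ((posSeq G (k * n + j.val) : ℕ) : ZMod n))

/-- Level description of the semigroup. -/
def Lev (k z : ℕ) : Prop :=
  ∃ m, z = 3 * (k * m) + m ∨ (z + 2 ≤ 3 * (k * m) + m ∧ 3 * (k * m) + m ≤ z + 3 * (m / 2))

lemma mem_iff_comb (a b c z : ℕ) :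
    z ∈ AddSubmonoid.closure ({a, b, c} : Set ℕ) ↔ ∃ x y w, z = x * a + y * b + w * c := by
  constructor
  · intro h
    induction h using AddSubmonoid.closure_induction with
    | mem x hx =>
      rcases hx with rfl | rfl | rfl
      · exact ⟨1, 0, 0, by simp⟩
      · exact ⟨0, 1, 0, by simp⟩
      · exact ⟨0, 0, 1, by simp⟩
    | zero => exact ⟨0, 0, 0, by simp⟩
    | add u v _ _ hu hv =>
      obtain ⟨x, y, w, rfl⟩ := hu
      obtain ⟨x', y', w', rfl⟩ := hv
      exact ⟨x + x', y + y', w + w', by ring⟩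
  · rintro ⟨x, y, w, rfl⟩
    have ha : a ∈ AddSubmonoid.closure ({a, b, c} : Set ℕ) :=
      AddSubmonoid.subset_closure (by simp)
    have hb : b ∈ AddSubmonoid.closure ({a, b, c} : Set ℕ) :=
      AddSubmonoid.subset_closure (by simp)
    have hc : c ∈ AddSubmonoid.closure ({a, b, c} : Set ℕ) :=
      AddSubmonoid.subset_closure (by simp)
    have := add_mem (add_mem (AddSubmonoid.nsmul_mem _ ha x) (AddSubmonoid.nsmul_mem _ hb y))
      (AddSubmonoid.nsmul_mem _ hc w)
    simpa using this

lemma comb_val (k : ℕ) (hk : 0 < k) (x y w : ℕ) :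
    x * (3 * k + 1) + y * (6 * k - 1) + w * (6 * k) + y = 3 * (k * (x + 2 * (y + w))) + x := by
  obtain ⟨b, hb⟩ : ∃ b, 6 * k = b + 1 := ⟨6 * k - 1, by omega⟩
  have : 6 * k - 1 = b := by omega
  rw [this]
  have h2 : y * (6 * k) = y * b + y := by rw [hb]; ring
  nlinarith

lemma mem_iff_lev (k : ℕ) (hk : 0 < k) (z : ℕ) :
    z ∈ AddSubmonoid.closure ({3 * k + 1, 6 * k - 1, 6 * k} : Set ℕ) ↔ Lev k z := by
  rw [mem_iff_comb]
  constructor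
  · rintro ⟨x, y, w, hz⟩
    have h := comb_val k hk x y w
    rw [← hz] at h
    refine ⟨x + 2 * (y + w), ?_⟩
    omega
  · rintro ⟨m, h⟩
    obtain ⟨y, w, h1, h2⟩ : ∃ y w, 2 * (y + w) ≤ m ∧ 3 * (k * m) + m = z + (3 * y + 2 * w) := by
      rcases h with h | ⟨h1, h2⟩
      · exact ⟨0, 0, by omega, by omega⟩
      · obtain ⟨d, hd⟩ : ∃ d, 3 * (k * m) + m = z + d := ⟨3 * (k * m) + m - z, by omega⟩
        have h3 : d % 3 = 0 ∨ d % 3 = 1 ∨ d % 3 = 2 := by omega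
        rcases h3 with h3 | h3 | h3
        · exact ⟨d / 3, 0, by omega, by omega⟩
        · exact ⟨d / 3 - 1, 2, by omega, by omega⟩
        · exact ⟨d / 3, 1, by omega, by omega⟩
    refine ⟨m - 2 * (y + w), y, w, ?_⟩
    have h := comb_val k hk (m - 2 * (y + w)) y w
    have e : m - 2 * (y + w) + 2 * (y + w) = m := by omega
    rw [e] at h
    omega

/-- First element of a level. -/
def st (k m : ℕ) : ℕ := 3 * (k * m) + m - 3 * (m / 2)

lemma le_mul_k (k : ℕ) (hk : 0 < k) (m : ℕ) : m ≤ k * m := Nat.le_mul_of_pos_left m hk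

lemma st_lt (k : ℕ) (hk : 0 < k) (m : ℕ) : st k m < st k (m + 1) := by
  have h1 := le_mul_k k hk m
  have h2 : k * (m + 1) = k * m + k := by ring
  unfold st
  omega

lemma st_mono (k : ℕ) (hk : 0 < k) : StrictMono (st k) := strictMono_nat_of_lt_succ (st_lt k hk)

lemma lev_big_aux (k : ℕ) (hk : 0 < k) (i : ℕ) :
    ∀ z, st k (2 * k + 1) ≤ z → z < st k (2 * k + 1 + i) → Lev k z := by
  induction i with
  | zero => intro z h1 h2; simp at h2; omega
  | succ i ih =>
    intro z h1 h2
    by_cases h : z < st k (2 * k + 1 + i)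
    · exact ih z h1 h
    · refine ⟨2 * k + 1 + i, ?_⟩
      have h3 := le_mul_k k hk (2 * k + 1 + i)
      have h4 : k * (2 * k + 1 + (i + 1)) = k * (2 * k + 1 + i) + k := by ring
      unfold st at h h2
      rw [h4] at h2
      generalize k * (2 * k + 1 + i) = P at *
      omega

lemma lev_big (k : ℕ) (hk : 0 < k) (z : ℕ) (h : st k (2 * k + 1) ≤ z) : Lev k z := by
  refine lev_big_aux k hk (z + 1) z h ?_
  have := (st_mono k hk).le_apply (x := 2 * k + 1 + (z + 1))
  omega

/-- Gap lemma. -/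
lemma lev_gap (k : ℕ) (hk : 0 < k) (m z : ℕ) (hm : m ≤ 2 * k) (h1 : 3 * (k * m) + m ≤ z + 1)
    (h2 : z < st k (m + 1)) (h3 : Lev k z) : z = 3 * (k * m) + m := by
  obtain ⟨n, hn⟩ := h3
  have a1 := le_mul_k k hk m
  have a2 := le_mul_k k hk n
  rcases lt_trichotomy n m with h | h | h
  · have : k * (n + 1) ≤ k * m := Nat.mul_le_mul_left k h
    have e : k * (n + 1) = k * n + k := by ring
    omega
  · subst h; omega
  · have : st k (m + 1) ≤ st k n := (st_mono k hk).monotone h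
    have e : st k n ≤ z := by unfold st; omega
    omega

/-- The set predicate. -/
def PP (k z : ℕ) : Prop := Lev k z ∧ 0 < z

/-- `y` is the successor of `x`. -/
def Nxt (k x y : ℕ) : Prop := PP k y ∧ x < y ∧ ∀ z, x < z → z < y → ¬ PP k z

/-- Block start invariant. -/
def BInv (k x : ℕ) : Prop :=
  (∃ m, 1 ≤ m ∧ m ≤ 2 * k ∧ x = 3 * (k * m) + m) ∨
  (∃ m r, 1 ≤ m ∧ m ≤ 2 * k ∧ 1 ≤ r ∧ r + 1 ≤ m / 2 ∧ x + (3 * r + 1) = 3 * (k * m) + m) ∨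
  st k (2 * k + 1) ≤ x

lemma nxt_succ (k x : ℕ) (h : Lev k (x + 1)) : Nxt k x (x + 1) :=
  ⟨⟨h, by omega⟩, by omega, fun z _ _ => by omega⟩

/-- The three elements of a block have distinct residues. -/
def BDist (x y z : ℕ) : Prop := x % 3 ≠ y % 3 ∧ x % 3 ≠ z % 3 ∧ y % 3 ≠ z % 3

lemma nxt_top (k : ℕ) (hk : 0 < k) (m : ℕ) (h1 : 1 ≤ m) (hm : m ≤ 2 * k) :
    Nxt k (3 * (k * m) + m) (st k (m + 1)) ∧ Lev k (st k (m + 1) + 1) ∧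
      BDist (3 * (k * m) + m) (st k (m + 1)) (st k (m + 1) + 1) := by
  have a1 := le_mul_k k hk m
  have e : k * (m + 1) = k * m + k := by ring
  have hs : st k (m + 1) = 3 * (k * m) + 3 * k + (m + 1) - 3 * ((m + 1) / 2) := by
    unfold st; rw [e]; omega
  refine ⟨⟨⟨⟨m + 1, ?_⟩, by omega⟩, by omega, ?_⟩, ⟨m + 1, ?_⟩, ?_⟩
  · rw [e]; omega
  · intro z hz1 hz2 hp
    have := lev_gap k hk m z hm (by omega) hz2 hp.1
    omega
  · rw [e]; omega
  · unfold BDist; omega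

lemma block (k : ℕ) (hk : 0 < k) (x : ℕ) (h : BInv k x) :
    ∃ y1 y2 y3, Nxt k x y1 ∧ Nxt k y1 y2 ∧ Nxt k y2 y3 ∧ BInv k y3 ∧ BDist x y1 y2 := by
  rcases h with ⟨m, h1, h2, rfl⟩ | ⟨m, r, h1, h2, h3, h4, hx⟩ | h
  · obtain ⟨n1, l2, d⟩ := nxt_top k hk m h1 h2
    have a1 := le_mul_k k hk m
    have e : k * (m + 1) = k * m + k := by ring
    have hs : st k (m + 1) = 3 * (k * m) + 3 * k + (m + 1) - 3 * ((m + 1) / 2) := by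
      unfold st; rw [e]; omega
    rcases Nat.lt_or_ge m (2 * k) with hm | hm
    · by_cases hT : (m + 1) / 2 = 1
      · refine ⟨_, _, st k (m + 1) + 3, n1, nxt_succ k _ l2, ⟨⟨⟨m + 1, ?_⟩, by omega⟩, by omega, ?_⟩,
          Or.inl ⟨m + 1, by omega, by omega, ?_⟩, d⟩
        · rw [e]; omega
        · intro z hz1 hz2 hp
          have b := st_lt k hk (m + 1)
          have e2 : k * (m + 1 + 1) = k * m + k + k := by ring
          have hs2 : st k (m + 1 + 1) = 3 * (k * m) + 3 * k + 3 * k + (m + 1 + 1) - 3 * ((m + 1 + 1) / 2) := by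
            unfold st; rw [e2]; omega
          have := lev_gap k hk (m + 1) z hm (by rw [e]; omega) (by omega) hp.1
          rw [e] at this
          omega
        · rw [e]; omega
      · refine ⟨_, _, _, n1, nxt_succ k _ l2, nxt_succ k _ ⟨m + 1, ?_⟩,
          Or.inr (Or.inl ⟨m + 1, (m + 1) / 2 - 1, by omega, by omega, by omega, by omega, ?_⟩), d⟩
        · rw [e]; omega
        · rw [e]; omega
    · have : m = 2 * k := by omega
      subst this
      exact ⟨_, _, _, n1, nxt_succ k _ l2, nxt_succ k _ (lev_big k hk _ (by omega)),
        Or.inr (Or.inr (by omega)), d⟩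
  · have a1 := le_mul_k k hk m
    have l1 : Lev k (x + 1) := ⟨m, by omega⟩
    have l2 : Lev k (x + 2) := ⟨m, by omega⟩
    have d : BDist x (x + 1) (x + 2) := by unfold BDist; omega
    by_cases hr : r = 1
    · refine ⟨x + 1, x + 2, x + 4, nxt_succ k _ l1, nxt_succ k _ l2,
        ⟨⟨⟨m, by omega⟩, by omega⟩, by omega, ?_⟩, Or.inl ⟨m, h1, h2, by omega⟩, d⟩
      intro z hz1 hz2 hp
      have b := (nxt_top k hk m h1 h2).1.2.1
      have := lev_gap k hk m z h2 (by omega) (by omega) hp.1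
      omega
    · exact ⟨x + 1, x + 2, x + 3, nxt_succ k _ l1, nxt_succ k _ l2,
        nxt_succ k _ ⟨m, by omega⟩,
        Or.inr (Or.inl ⟨m, r - 1, by omega, by omega, by omega, by omega, by omega⟩), d⟩
  · exact ⟨x + 1, x + 2, x + 3, nxt_succ k _ (lev_big k hk _ (by omega)),
      nxt_succ k _ (lev_big k hk _ (by omega)), nxt_succ k _ (lev_big k hk _ (by omega)),
      Or.inr (Or.inr (by omega)), by unfold BDist; omega⟩

open Classical in
/-- `x` is the `n`-th element. -/
def EE (k n x : ℕ) : Prop := PP k x ∧ Nat.count (PP k) x = n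

open Classical in
lemma EE_next (k n x y : ℕ) (h : EE k n x) (hy : Nxt k x y) : EE k (n + 1) y := by
  refine ⟨hy.1, ?_⟩
  have key : ∀ i, x + 1 + i ≤ y → Nat.count (PP k) (x + 1 + i) = n + 1 := by
    intro i
    induction i with
    | zero => intro _; simp [Nat.count_succ, h.1, h.2]
    | succ i ih =>
      intro hi
      have := hy.2.2 (x + 1 + i) (by omega) (by omega)
      rw [← add_assoc, Nat.count_succ, ih (by omega)]
      simp [this]
  have hlt := hy.2.1
  have := key (y - (x + 1)) (by omega)
  rwa [show x + 1 + (y - (x + 1)) = y by omega] at this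

open Classical in
lemma EE_nth (k n x : ℕ) (h : EE k n x) : Nat.nth (PP k) n = x := by
  rw [← h.2]; exact Nat.nth_count h.1

open Classical in
lemma EE_zero (k : ℕ) (hk : 0 < k) : EE k 0 (3 * k + 1) := by
  refine ⟨⟨⟨1, by omega⟩, by omega⟩, ?_⟩
  rw [Nat.count_iff_forall_not]
  intro z hz hp
  have e : st k (0 + 1) = 3 * k + 1 := by simp [st]
  have := lev_gap k hk 0 z (by omega) (by omega) (by omega) hp.1
  have := hp.2
  omega

lemma exists_start (k : ℕ) (hk : 0 < k) (j : ℕ) : ∃ x, EE k (j * 3) x ∧ BInv k x := by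
  induction j with
  | zero => exact ⟨_, by simpa using EE_zero k hk, Or.inl ⟨1, by omega, by omega, by omega⟩⟩
  | succ j ih =>
    obtain ⟨x, hx, hi⟩ := ih
    obtain ⟨y1, y2, y3, n1, n2, n3, hi3, _⟩ := block k hk x hi
    refine ⟨y3, ?_, hi3⟩
    have := EE_next _ _ _ _ (EE_next _ _ _ _ (EE_next _ _ _ _ hx n1) n2) n3
    rwa [show j * 3 + 1 + 1 + 1 = (j + 1) * 3 by ring] at this

theorem family6_is_three_permutation (k : ℕ) (hk : 0 < k) :
    IsPermutationSemigroup 3 (AddSubmonoid.closure ({3 * k + 1, 6 * k - 1, 6 * k} : Set ℕ)) := by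
  have hseq : posSeq (AddSubmonoid.closure ({3 * k + 1, 6 * k - 1, 6 * k} : Set ℕ))
      = Nat.nth (PP k) := by
    unfold posSeq
    congr 1
    funext z
    simp only [mem_iff_lev k hk, PP]
  refine ⟨?_, ?_, ?_⟩
  · refine (Set.finite_Iio (st k (2 * k + 1))).subset ?_
    intro z hz
    by_contra h
    apply hz
    exact (mem_iff_lev k hk z).2 (lev_big k hk z (by simpa using h))
  · rw [hseq]
    congr 1
    have e0 := EE_zero k hk
    obtain ⟨n1, l2, _⟩ := nxt_top k hk 1 le_rfl (by omega)
    have e : st k (1 + 1) = 6 * k - 1 := by simp [st]; omega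
    rw [e] at n1 l2
    rw [show 3 * (k * 1) + 1 = 3 * k + 1 by ring] at n1
    have e1 := EE_next _ _ _ _ e0 n1
    have e2 := EE_next _ _ _ _ e1 (nxt_succ k _ l2)
    rw [show 6 * k - 1 + 1 = 6 * k by omega] at e2
    have f0 := EE_nth _ _ _ e0
    have f1 := EE_nth _ _ _ e1
    have f2 := EE_nth _ _ _ e2
    simp only [zero_add, Nat.reduceAdd] at f1 f2
    have hI : Set.Iio 3 = ({0, 1, 2} : Set ℕ) := by
      ext i; simp; omega
    rw [hI, Set.image_insert_eq, Set.image_pair, f0, f1, f2]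
  · intro j
    rw [hseq]
    obtain ⟨x, hx, hi⟩ := exists_start k hk j
    obtain ⟨y1, y2, y3, n1, n2, _, _, d1, d2, d3⟩ := block k hk x hi
    have e1 := EE_next _ _ _ _ hx n1
    have e2 := EE_next _ _ _ _ e1 n2
    have f0 := EE_nth _ _ _ hx
    have f1 := EE_nth _ _ _ e1
    have f2 := EE_nth _ _ _ e2
    rw [Fintype.bijective_iff_injective_and_card]
    refine ⟨?_, by simp⟩
    intro a b hab
    simp only [ZMod.natCast_eq_natCast_iff'] at hab
    have g0 : Nat.nth (PP k) (j * 3 + 0) = x := f0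
    have g2 : Nat.nth (PP k) (j * 3 + 2) = y2 := f2
    fin_cases a <;> fin_cases b <;> simp only [g0, f1, g2] at hab ⊢ <;> omega
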